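/- Set ξ* := −12^{1/3}. Let Γ be a discrete, torsion-free subgroup of PSL(2,ℝ) acting on the upper half-plane ℍ by Möbius transformations with compact quotient, let φ : ℍ → ℝ be a smooth Γ-invariant function, and let v : (ξ*, 0] × ℍ → ℝ be a twice continuously differentiable solution, Γ-invariant in the ℍ-variable, of y²·(v_{xx} + v_{yy}) + (e^v)_{ξξ} = −2 − ξ·((12 − 6ξ v_ξ)/(12 + ξ³))·e^v with v(0,·) = φ such that v − 2·log(ξ − ξ*) is bounded. Then there exist constants a ∈ ℝ, C > 0, and δ > 0 such that |v(ξ,z) − v_mod(ξ)| ≤ C·(ξ − ξ*)^δ for all ξ ∈ (ξ*, 0) and all z ∈ ℍ, where v_mod(ξ) := 2·log(ξ − ξ*) + log(1/3 − (ξ*²/18)·ξ + (a/24)·(ξ*² − ξ²)). -/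

import Mathlib

open Real

noncomputable section

/-- `ξ* = −12^{1/3}`. -/
def xiStar : ℝ := -(12 : ℝ) ^ ((1:ℝ)/3)

/-- `SL(2,ℝ)`. -/
abbrev SL2R := Matrix.SpecialLinearGroup (Fin 2) ℝ

/-- The Möbius transformation of `ℂ` associated to `g ∈ SL(2,ℝ)`. -/
def moebius (g : SL2R) (z : ℂ) : ℂ :=
  ((g.1 0 0 : ℝ) * z + (g.1 0 1 : ℝ)) / ((g.1 1 0 : ℝ) * z + (g.1 1 1 : ℝ))

/-- A subgroup of `SL(2,ℝ)` is discrete iff its intersection with every bounded set of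
matrices is finite. -/
def IsDiscreteSubgroup (Γ : Subgroup SL2R) : Prop :=
  ∀ R : ℝ, {g : SL2R | g ∈ Γ ∧ ∀ i j : Fin 2, |g.1 i j| ≤ R}.Finite

/-- The image of `Γ` in `PSL(2,ℝ)` is torsion-free: no nontrivial element of `Γ` has a
power equal to `±1`. -/
def TorsionFreeInPSL (Γ : Subgroup SL2R) : Prop :=
  ∀ g ∈ Γ, ∀ n : ℕ, 0 < n →
    ((g ^ n).1 = (1 : Matrix (Fin 2) (Fin 2) ℝ) ∨
      (g ^ n).1 = (-1 : Matrix (Fin 2) (Fin 2) ℝ)) → g = 1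

/-- The quotient `Γ\ℍ` is compact: some compact subset of the upper half-plane meets
every `Γ`-orbit. -/
def IsCocompact (Γ : Subgroup SL2R) : Prop :=
  ∃ F : Set ℂ, IsCompact F ∧ (∀ z ∈ F, 0 < z.im) ∧
    ∀ z : ℂ, 0 < z.im → ∃ g ∈ Γ, moebius g z ∈ F

/-- `Γ`-invariance of a function on the upper half-plane (coordinates `(x,y)`, `y > 0`). -/
def GammaInvariant (Γ : Subgroup SL2R) (f : ℝ → ℝ → ℝ) : Prop :=
  ∀ g ∈ Γ, ∀ x y : ℝ, 0 < y →
    f (moebius g (⟨x, y⟩ : ℂ)).re (moebius g (⟨x, y⟩ : ℂ)).im = f x y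

/-- A C² solution on `(ξ*,0] × ℍ`, `Γ`-invariant in the `ℍ`-variable, of the hyperbolic
twisted Toda equation
`y²(v_{xx} + v_{yy}) + (e^v)_{ξξ} = −2 − ξ((12 − 6ξv_ξ)/(12 + ξ³))e^v`,
with boundary value `φ` at `ξ = 0` and `v − 2log(ξ − ξ*)` bounded (BVP4). -/
def IsSolBVP4 (Γ : Subgroup SL2R) (φ : ℝ → ℝ → ℝ) (v : ℝ → ℝ → ℝ → ℝ) : Prop :=
  ContDiffOn ℝ 2 (fun p : ℝ × ℝ × ℝ => v p.1 p.2.1 p.2.2)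
    {p : ℝ × ℝ × ℝ | xiStar < p.1 ∧ p.1 ≤ 0 ∧ 0 < p.2.2} ∧
  (∀ ξ : ℝ, xiStar < ξ → ξ ≤ 0 → GammaInvariant Γ (v ξ)) ∧
  (∀ x y : ℝ, 0 < y → v 0 x y = φ x y) ∧
  (∃ M : ℝ, ∀ ξ : ℝ, xiStar < ξ → ξ < 0 → ∀ x y : ℝ, 0 < y →
    |v ξ x y - 2 * Real.log (ξ - xiStar)| ≤ M) ∧
  (∀ ξ : ℝ, xiStar < ξ → ξ < 0 → ∀ x y : ℝ, 0 < y →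
    y ^ 2 * (deriv (deriv (fun x' => v ξ x' y)) x + deriv (deriv (fun y' => v ξ x y')) y) +
        deriv (deriv (fun s => Real.exp (v s x y))) ξ =
      -2 - ξ * ((12 - 6 * ξ * deriv (fun s => v s x y) ξ) / (12 + ξ ^ 3)) *
        Real.exp (v ξ x y))

open Set Filter Topology

/-- Second-order necessary condition at a local maximum. -/
lemma deriv_deriv_nonpos_of_isLocalMax {f : ℝ → ℝ} {x : ℝ} (h : IsLocalMax f x)
    (hc : ContinuousAt f x) : deriv (deriv f) x ≤ 0 := by
  by_contra! hpos
  have hmin := isLocalMin_of_deriv_deriv_pos hpos h.deriv_eq_zero hc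
  have hconst : f =ᶠ[𝓝 x] fun _ => f x := by
    filter_upwards [h, hmin] with y h1 h2 using le_antisymm h1 h2
  have hd : deriv f =ᶠ[𝓝 x] fun _ => 0 := by
    simpa using hconst.deriv
  simp [hd.deriv_eq] at hpos

/-- The general `ℍ`-independent solution `e^v` of the twisted Toda equation. -/
def radialSol (α β s : ℝ) : ℝ := -s ^ 2 + α * (1 - s ^ 3 / 6) + β * (s - s ^ 4 / 24)

lemma hasDerivAt_radialSol (α β s : ℝ) :
    HasDerivAt (radialSol α β) (-2 * s - α * s ^ 2 / 2 + β * (1 - s ^ 3 / 6)) s := by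
  have h := ((hasDerivAt_pow 2 s).neg.add
    ((((hasDerivAt_pow 3 s).div_const 6).const_sub 1).const_mul α)).add
    (((hasDerivAt_id s).sub ((hasDerivAt_pow 4 s).div_const 24)).const_mul β)
  refine h.congr_deriv ?_
  norm_num
  ring

lemma deriv_radialSol (α β : ℝ) :
    deriv (radialSol α β) = fun s => -2 * s - α * s ^ 2 / 2 + β * (1 - s ^ 3 / 6) :=
  funext fun s => (hasDerivAt_radialSol α β s).deriv

lemma hasDerivAt_deriv_radialSol (α β s : ℝ) :
    HasDerivAt (deriv (radialSol α β)) (-2 - α * s - β * s ^ 2 / 2) s := by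
  rw [deriv_radialSol]
  have h := (((hasDerivAt_id s).const_mul (-2)).sub
    (((hasDerivAt_pow 2 s).const_mul α).div_const 2)).add
    ((((hasDerivAt_pow 3 s).div_const 6).const_sub 1).const_mul β)
  refine h.congr_deriv ?_
  norm_num
  ring

lemma continuous_radialSol (α β : ℝ) : Continuous (radialSol α β) := by
  unfold radialSol
  fun_prop

lemma moebius_im_pos (g : SL2R) {z : ℂ} (hz : 0 < z.im) : 0 < (moebius g z).im := by
  have hdet := g.2
  rw [Matrix.det_fin_two] at hdet
  have hne : ((g.1 1 0 : ℝ) * z + (g.1 1 1 : ℝ) : ℂ) ≠ 0 := by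
    intro h0
    have him := congrArg Complex.im h0
    have hre := congrArg Complex.re h0
    simp at him hre
    rcases him with hc | hc
    · rw [hc] at hre hdet
      simp at hre
      rw [hre] at hdet
      simp at hdet
    · exact hz.ne' hc
  have hn := Complex.normSq_pos.2 hne
  have key : (moebius g z).im =
      z.im / Complex.normSq ((g.1 1 0 : ℝ) * z + (g.1 1 1 : ℝ)) := by
    unfold moebius
    rw [Complex.div_im]
    rw [← sub_div]
    congr 1
    simp
    linear_combination z.im * hdet
  rw [key]
  positivity

/-- A continuous family of `Γ`-invariant functions over a compact interval attains its maximum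
when `Γ` is cocompact. -/
lemma IsCocompact.exists_forall_le {Γ : Subgroup SL2R} (hcc : IsCocompact Γ)
    {G : ℝ → ℝ → ℝ → ℝ} {s₁ s₂ : ℝ} (hs : s₁ ≤ s₂)
    (hG : ContinuousOn (fun p : ℝ × ℝ × ℝ => G p.1 p.2.1 p.2.2)
      {p | p.1 ∈ Icc s₁ s₂ ∧ 0 < p.2.2})
    (hinv : ∀ s ∈ Icc s₁ s₂, GammaInvariant Γ (G s)) :
    ∃ s ∈ Icc s₁ s₂, ∃ x y : ℝ, 0 < y ∧
      ∀ s' ∈ Icc s₁ s₂, ∀ x' y' : ℝ, 0 < y' → G s' x' y' ≤ G s x y := by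
  obtain ⟨F, hF, hpos, horb⟩ := hcc
  obtain ⟨g, -, hg⟩ := horb Complex.I (by simp)
  have hcont : ContinuousOn (fun p : ℝ × ℂ => G p.1 p.2.re p.2.im) (Icc s₁ s₂ ×ˢ F) := by
    have hmap : ContinuousOn (fun p : ℝ × ℂ => (p.1, p.2.re, p.2.im)) (Icc s₁ s₂ ×ˢ F) := by
      fun_prop
    exact hG.comp hmap fun p hp => ⟨hp.1, hpos _ hp.2⟩
  obtain ⟨⟨s, z⟩, ⟨hs', hz⟩, hmax⟩ := (isCompact_Icc.prod hF).exists_isMaxOn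
    ⟨(s₁, moebius g Complex.I), ⟨left_mem_Icc.2 hs, hg⟩⟩ hcont
  refine ⟨s, hs', z.re, z.im, hpos _ hz, fun s' hs'' x' y' hy' => ?_⟩
  obtain ⟨g', hg', hgF⟩ := horb ⟨x', y'⟩ hy'
  rw [← hinv s' hs'' g' hg' x' y' hy']
  exact hmax (show (s', moebius g' ⟨x', y'⟩) ∈ Icc s₁ s₂ ×ˢ F from ⟨hs'', hgF⟩)

lemma xiStar_cube : xiStar ^ 3 = -12 := by
  have h : ((12 : ℝ) ^ ((1 : ℝ) / 3)) ^ 3 = 12 := by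
    rw [← Real.rpow_natCast, ← Real.rpow_mul (by norm_num)]
    norm_num
  unfold xiStar
  linear_combination -h

lemma xiStar_neg : xiStar < 0 := by
  unfold xiStar
  have : (0 : ℝ) < 12 ^ ((1 : ℝ) / 3) := by positivity
  linarith

lemma twelve_add_cube_pos {ξ : ℝ} (h : xiStar < ξ) : 0 < 12 + ξ ^ 3 := by
  have h3 : xiStar ^ 3 < ξ ^ 3 := (Odd.strictMono_pow (by decide : Odd 3)) h
  linarith [xiStar_cube]

/-- Comparison principle against radial solutions; `σ = 1` bounds `e^v` from above and
`σ = -1` from below. -/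
lemma IsSolBVP4.comparison {Γ : Subgroup SL2R} (hcc : IsCocompact Γ) {φ : ℝ → ℝ → ℝ}
    {v : ℝ → ℝ → ℝ → ℝ} (hv : IsSolBVP4 Γ φ v) {σ : ℝ} (hσ : σ = 1 ∨ σ = -1) (α β : ℝ)
    {s₁ s₂ : ℝ} (h1 : xiStar < s₁) (h12 : s₁ ≤ s₂) (h2 : s₂ < 0)
    (hb1 : ∀ x y : ℝ, 0 < y → σ * (exp (v s₁ x y) - radialSol α β s₁) ≤ 0)
    (hb2 : ∀ x y : ℝ, 0 < y → σ * (exp (v s₂ x y) - radialSol α β s₂) ≤ 0)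
    {s x y : ℝ} (hs : s ∈ Icc s₁ s₂) (hy : 0 < y) :
    σ * (exp (v s x y) - radialSol α β s) ≤ 0 := by
  obtain ⟨hreg, hinv, -, -, hpde⟩ := hv
  have hregAt : ∀ s x y : ℝ, xiStar < s → s < 0 → 0 < y →
      ContDiffAt ℝ 2 (fun p : ℝ × ℝ × ℝ => v p.1 p.2.1 p.2.2) (s, x, y) := by
    intro s x y hs1 hs2 hy
    refine hreg.contDiffAt ?_
    have hopen : IsOpen {p : ℝ × ℝ × ℝ | xiStar < p.1 ∧ p.1 < 0 ∧ 0 < p.2.2} :=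
      (isOpen_lt continuous_const continuous_fst).inter
        ((isOpen_lt continuous_fst continuous_const).inter
          (isOpen_lt continuous_const (continuous_snd.comp continuous_snd)))
    exact mem_of_superset (hopen.mem_nhds ⟨hs1, hs2, hy⟩) fun p hp => ⟨hp.1, hp.2.1.le, hp.2.2⟩
  obtain ⟨t, ht, a, b, hb, hmax⟩ := hcc.exists_forall_le
    (G := fun s x y => σ * (exp (v s x y) - radialSol α β s)) h12
    (by
      have hc : ContinuousOn (fun p : ℝ × ℝ × ℝ => v p.1 p.2.1 p.2.2)
          {p | p.1 ∈ Icc s₁ s₂ ∧ 0 < p.2.2} :=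
        hreg.continuousOn.mono fun p hp => ⟨h1.trans_le hp.1.1, hp.1.2.trans h2.le, hp.2⟩
      have hr : Continuous fun p : ℝ × ℝ × ℝ => radialSol α β p.1 :=
        (continuous_radialSol α β).comp continuous_fst
      exact continuousOn_const.mul (hc.rexp.sub hr.continuousOn))
    (by
      intro s hs g hg x y hy
      simp only [hinv s (h1.trans_le hs.1) (hs.2.trans h2.le) g hg x y hy])
  refine (hmax s hs x y hy).trans ?_
  by_contra! hpos
  have ht1 : s₁ < t := lt_of_le_of_ne ht.1 fun h => by
    subst h; exact absurd (hb1 a b hb) (not_le.2 hpos)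
  have ht2 : t < s₂ := lt_of_le_of_ne ht.2 fun h => by
    subst h; exact absurd (hb2 a b hb) (not_le.2 hpos)
  have htneg : t < 0 := ht2.trans h2
  have htpos := twelve_add_cube_pos (h1.trans ht1)
  have hCv := hregAt t a b (h1.trans ht1) htneg hb
  have hspace : ∀ x' y' : ℝ, 0 < y' → σ * v t x' y' ≤ σ * v t a b := by
    intro x' y' hy'
    have hm := hmax t ht x' y' hy'
    rcases hσ with rfl | rfl
    · have : exp (v t x' y') ≤ exp (v t a b) := by linarith
      linarith [exp_le_exp.1 this]
    · have : exp (v t a b) ≤ exp (v t x' y') := by linarith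
      linarith [exp_le_exp.1 this]
  have hxx : σ * deriv (deriv fun x' => v t x' b) a ≤ 0 := by
    have hc : ContinuousAt (fun x' => v t x' b) a :=
      hCv.continuousAt.comp (f := fun x' : ℝ => (t, x', b)) (by fun_prop)
    have hl : IsLocalMax (fun x' => σ * v t x' b) a :=
      Eventually.of_forall fun x' => hspace x' b hb
    simpa using deriv_deriv_nonpos_of_isLocalMax hl (continuousAt_const.mul hc)
  have hyy : σ * deriv (deriv fun y' => v t a y') b ≤ 0 := by
    have hc : ContinuousAt (fun y' => v t a y') b :=
      hCv.continuousAt.comp (f := fun y' : ℝ => (t, a, y')) (by fun_prop)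
    have hl : IsLocalMax (fun y' => σ * v t a y') b :=
      (eventually_gt_nhds hb).mono fun y' hy' => hspace a y' hy'
    simpa using deriv_deriv_nonpos_of_isLocalMax hl (continuousAt_const.mul hc)
  have hCs : ContDiffAt ℝ 2 (fun s => v s a b) t :=
    hCv.comp t (f := fun s : ℝ => (s, a, b)) (by fun_prop)
  have hCe : ContDiffAt ℝ 2 (fun s => exp (v s a b)) t := hCs.exp
  have hvd : DifferentiableAt ℝ (fun s => v s a b) t := hCs.differentiableAt (by norm_num)
  have hl : IsLocalMax (fun s => σ * (exp (v s a b) - radialSol α β s)) t := by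
    filter_upwards [Icc_mem_nhds ht1 ht2] with s hs using hmax s hs a b hb
  have hσ0 : σ ≠ 0 := by rcases hσ with rfl | rfl <;> norm_num
  have hEd : HasDerivAt (fun s => exp (v s a b)) (exp (v t a b) * deriv (fun s => v s a b) t) t :=
    hvd.hasDerivAt.exp
  have hfirst : exp (v t a b) * deriv (fun s => v s a b) t =
      -2 * t - α * t ^ 2 / 2 + β * (1 - t ^ 3 / 6) := by
    have h0 := hl.hasDerivAt_eq_zero ((hEd.sub (hasDerivAt_radialSol α β t)).const_mul σ)
    linarith [(mul_eq_zero.1 h0).resolve_left hσ0]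
  have hsecond : σ * (deriv (deriv fun s => exp (v s a b)) t - (-2 - α * t - β * t ^ 2 / 2)) ≤ 0 := by
    have hev : deriv (fun s => σ * (exp (v s a b) - radialSol α β s)) =ᶠ[𝓝 t]
        fun s => σ * (deriv (fun s => exp (v s a b)) s - deriv (radialSol α β) s) := by
      filter_upwards [hCe.eventually (by simp)] with s hs
      exact (((hs.differentiableAt (by norm_num)).hasDerivAt.sub
        (hasDerivAt_radialSol α β s).differentiableAt.hasDerivAt).const_mul σ).deriv
    have hdd : DifferentiableAt ℝ (deriv fun s => exp (v s a b)) t :=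
      ((hCe.fderiv_right (m := 1) (by norm_num)).clm_apply
        contDiffAt_const).differentiableAt (by norm_num)
    have hnonpos := deriv_deriv_nonpos_of_isLocalMax hl
      (continuousAt_const.mul
        (hCe.continuousAt.sub (continuous_radialSol α β).continuousAt))
    have hd := (hdd.hasDerivAt.sub (hasDerivAt_deriv_radialSol α β t)).const_mul σ
    rw [hev.deriv_eq] at hnonpos
    exact hd.deriv.symm.trans_le hnonpos
  have hp := hpde t (h1.trans ht1) htneg a b hb
  have hlap : σ * (b ^ 2 * (deriv (deriv fun x' => v t x' b) a +
      deriv (deriv fun y' => v t a y') b)) ≤ 0 := by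
    nlinarith [sq_nonneg b]
  generalize deriv (deriv fun s => exp (v s a b)) t = E2 at *
  generalize b ^ 2 * (deriv (deriv fun x' => v t x' b) a +
      deriv (deriv fun y' => v t a y') b) = L at *
  generalize deriv (fun s => v s a b) t = D at *
  generalize exp (v t a b) = E at *
  have hp' : (12 + t ^ 3) * (L + E2) = -2 * (12 + t ^ 3) - 12 * t * E + 6 * t ^ 2 * (E * D) := by
    rw [hp]
    field_simp
    ring
  rw [hfirst] at hp'
  have hid : (12 + t ^ 3) * (σ * L + σ * (E2 - (-2 - α * t - β * t ^ 2 / 2))) =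
      -12 * t * (σ * (E - radialSol α β t)) := by
    unfold radialSol
    linear_combination σ * hp'
  have hneg : (12 + t ^ 3) * (σ * L + σ * (E2 - (-2 - α * t - β * t ^ 2 / 2))) ≤ 0 :=
    mul_nonpos_of_nonneg_of_nonpos htpos.le (add_nonpos hlap hsecond)
  nlinarith [mul_pos (neg_pos.2 htneg) hpos]


/-- The barriers: the model profile, a multiple of the homogeneous solution vanishing to third
order at `ξ*`, and a multiple of the one that does not vanish there. -/
lemma radialSol_barrier (K ε ξ : ℝ) :
    radialSol (xiStar ^ 2 / 3 - 12 * K * xiStar + 6 * ε) (24 * K) ξ =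
      (ξ - xiStar) ^ 2 * (1 / 3 - xiStar ^ 2 / 18 * ξ + K * (xiStar ^ 2 - ξ ^ 2)) +
        ε * (6 - ξ ^ 3) := by
  unfold radialSol
  linear_combination (-(1 / 9) * ξ ^ 2 + xiStar / 18 * ξ + 2 * K * ξ - K * xiStar) * xiStar_cube

lemma model_profile_mem {ξ : ℝ} (h1 : xiStar < ξ) (h2 : ξ < 0) :
    1 / 3 - xiStar ^ 2 / 18 * ξ ∈ Icc (1 / 3) 1 := by
  have hq : 0 < xiStar ^ 2 := sq_pos_of_neg xiStar_neg
  constructor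
  · nlinarith [mul_pos hq (neg_pos.2 h2)]
  · nlinarith [mul_pos hq (sub_pos.2 h1), xiStar_cube]

lemma abs_log_sub_log_le {m x y : ℝ} (hm : 0 < m) (hx : m ≤ x) (hy : m ≤ y) :
    |log x - log y| ≤ |x - y| / m := by
  have key : ∀ {x y : ℝ}, m ≤ x → m ≤ y → log x - log y ≤ |x - y| / m := by
    intro x y hx hy
    have hx0 := hm.trans_le hx
    have hy0 := hm.trans_le hy
    calc log x - log y = log (x / y) := (log_div hx0.ne' hy0.ne').symm
      _ ≤ x / y - 1 := log_le_sub_one_of_pos (by positivity)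
      _ = (x - y) / y := by field_simp
      _ ≤ |x - y| / y := by gcongr; exact le_abs_self _
      _ ≤ |x - y| / m := by gcongr
  refine abs_sub_le_iff.2 ⟨key hx hy, ?_⟩
  rw [abs_sub_comm]
  exact key hy hx

lemma exp_eq_sq_mul_exp {s w : ℝ} (hs : 0 < s) : exp w = s ^ 2 * exp (w - 2 * log s) := by
  have h : s ^ 2 = exp (2 * log s) := by
    rw [two_mul, exp_add, exp_log hs, sq]
  rw [h, ← exp_add]
  congr 1
  ring

/-- Near `ξ*`, `e^v` differs from `(ξ - ξ*)²` times the model profile by `O((ξ - ξ*)³)`. -/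
lemma IsSolBVP4.abs_exp_sub_le {Γ : Subgroup SL2R} (hcc : IsCocompact Γ) {φ : ℝ → ℝ → ℝ}
    {v : ℝ → ℝ → ℝ → ℝ} (hv : IsSolBVP4 Γ φ v) :
    ∃ K > 0, ∀ ξ : ℝ, xiStar < ξ → ξ ≤ xiStar / 2 → ∀ x y : ℝ, 0 < y →
      |exp (v ξ x y) - (ξ - xiStar) ^ 2 * (1 / 3 - xiStar ^ 2 / 18 * ξ)| ≤
        K * ((ξ - xiStar) ^ 2 * (xiStar ^ 2 - ξ ^ 2)) := by
  obtain ⟨M, hM⟩ := hv.2.2.2.1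
  have hq := xiStar_neg
  have hA : 0 < exp M + 1 := by positivity
  have hq2 : 0 < xiStar ^ 2 := sq_pos_of_neg hq
  have hcrude : ∀ {σ : ℝ}, (σ = 1 ∨ σ = -1) → ∀ {ξ : ℝ}, xiStar < ξ → ξ < 0 →
      ∀ x y : ℝ, 0 < y →
      σ * (exp (v ξ x y) - (ξ - xiStar) ^ 2 * (1 / 3 - xiStar ^ 2 / 18 * ξ)) ≤
        (ξ - xiStar) ^ 2 * (exp M + 1) := by
    intro σ hσ ξ h1 h2 x y hy
    have hs := sub_pos.2 h1
    have hw := exp_le_exp.2 (abs_le.1 (hM ξ h1 h2 x y hy)).2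
    have hw0 := exp_pos (v ξ x y - 2 * log (ξ - xiStar))
    obtain ⟨hb1, hb2⟩ := model_profile_mem h1 h2
    rw [exp_eq_sq_mul_exp hs, ← mul_sub, mul_left_comm]
    gcongr
    rcases hσ with rfl | rfl <;> linarith [exp_pos M]
  set K := (exp M + 1) / (3 / 4 * xiStar ^ 2) with hK
  have hK0 : 0 < K := by positivity
  refine ⟨K, hK0, fun ξ h1 h2 x y hy => ?_⟩
  have key : ∀ {σ : ℝ}, (σ = 1 ∨ σ = -1) → ∀ ε > 0,
      σ * (exp (v ξ x y) - (ξ - xiStar) ^ 2 * (1 / 3 - xiStar ^ 2 / 18 * ξ)) ≤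
        K * ((ξ - xiStar) ^ 2 * (xiStar ^ 2 - ξ ^ 2)) + ε * (6 - ξ ^ 3) := by
    intro σ hσ ε hε
    have hσσ : σ * σ = 1 := by rcases hσ with rfl | rfl <;> norm_num
    have hsplit : ∀ ξ' x' y' : ℝ,
        σ * (exp (v ξ' x' y') -
          radialSol (xiStar ^ 2 / 3 - 12 * (σ * K) * xiStar + 6 * (σ * ε)) (24 * (σ * K)) ξ') =
        σ * (exp (v ξ' x' y') - (ξ' - xiStar) ^ 2 * (1 / 3 - xiStar ^ 2 / 18 * ξ')) -
          (K * ((ξ' - xiStar) ^ 2 * (xiStar ^ 2 - ξ' ^ 2)) + ε * (6 - ξ' ^ 3)) := by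
      intro ξ' x' y'
      rw [radialSol_barrier]
      linear_combination
        (-(K * ((ξ' - xiStar) ^ 2 * (xiStar ^ 2 - ξ' ^ 2)) + ε * (6 - ξ' ^ 3))) * hσσ
    have hcube : ∀ {ξ' : ℝ}, ξ' < 0 → 6 * ε ≤ ε * (6 - ξ' ^ 3) := by
      intro ξ' h'
      nlinarith [mul_pos hε (neg_pos.2 (Odd.pow_neg (by decide : Odd 3) h'))]
    set η := min 1 (6 * ε / (exp M + 1)) with hη
    have hη0 : 0 < η := by positivity
    have hηA : η ^ 2 * (exp M + 1) ≤ 6 * ε := by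
      have hη1 : η ≤ 1 := min_le_left _ _
      have hη2 : η * (exp M + 1) ≤ 6 * ε := (le_div_iff₀ hA).1 (min_le_right _ _)
      nlinarith [mul_pos hη0 hA]
    set s₁ := min ξ (xiStar + η)
    have hs1 : xiStar < s₁ := lt_min h1 (by linarith)
    have hs1ξ : s₁ ≤ ξ := min_le_left _ _
    have hs1η : s₁ - xiStar ≤ η := by linarith [min_le_right ξ (xiStar + η)]
    have hs1neg : s₁ < 0 := by linarith
    have hmain := hv.comparison (x := x) hcc hσ
      (xiStar ^ 2 / 3 - 12 * (σ * K) * xiStar + 6 * (σ * ε)) (24 * (σ * K))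
      hs1 (hs1ξ.trans h2) (by linarith : xiStar / 2 < 0)
      (by
        intro x' y' hy'
        rw [hsplit]
        have hc := hcrude hσ hs1 hs1neg x' y' hy'
        have h0 := hcube hs1neg
        have hsq : (s₁ - xiStar) ^ 2 ≤ η ^ 2 := by
          have := sub_pos.2 hs1
          gcongr
        have hh : 0 ≤ xiStar ^ 2 - s₁ ^ 2 := by nlinarith
        have hKh : 0 ≤ K * ((s₁ - xiStar) ^ 2 * (xiStar ^ 2 - s₁ ^ 2)) := by positivity
        have := mul_le_mul_of_nonneg_right hsq hA.le
        linarith)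
      (by
        intro x' y' hy'
        rw [hsplit]
        have hc := hcrude hσ (by linarith : xiStar < xiStar / 2) (by linarith) x' y' hy'
        have h0 := hcube (by linarith : xiStar / 2 < 0)
        have hKe : K * ((xiStar / 2 - xiStar) ^ 2 * (xiStar ^ 2 - (xiStar / 2) ^ 2)) =
            (xiStar / 2 - xiStar) ^ 2 * (exp M + 1) := by
          rw [hK]
          field_simp
          ring
        linarith)
      ⟨hs1ξ, h2⟩ hy
    rw [hsplit] at hmain
    linarith
  have hlim : ∀ {σ : ℝ}, (σ = 1 ∨ σ = -1) →
      σ * (exp (v ξ x y) - (ξ - xiStar) ^ 2 * (1 / 3 - xiStar ^ 2 / 18 * ξ)) ≤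
        K * ((ξ - xiStar) ^ 2 * (xiStar ^ 2 - ξ ^ 2)) := by
    intro σ hσ
    have hpos : 0 < 6 - ξ ^ 3 := by
      linarith [Odd.pow_neg (by decide : Odd 3) (by linarith : ξ < 0)]
    refine le_of_forall_pos_le_add fun ε hε => ?_
    have h := key hσ (ε / (6 - ξ ^ 3)) (by positivity)
    rwa [div_mul_cancel₀ _ hpos.ne'] at h
  exact abs_le'.2 ⟨by linarith [hlim (Or.inl rfl)], by linarith [hlim (Or.inr rfl)]⟩

/-- Model asymptotics for BVP4: `v` converges to
`v_mod = 2log(ξ − ξ*) + log(1/3 − (ξ*²/18)ξ + (a/24)(ξ*² − ξ²))` at rate `(ξ − ξ*)^δ`. -/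
theorem stmt14
    (Γ : Subgroup SL2R)
    (hdisc : IsDiscreteSubgroup Γ) (htf : TorsionFreeInPSL Γ) (hcc : IsCocompact Γ)
    (φ : ℝ → ℝ → ℝ)
    (hφreg : ContDiffOn ℝ (⊤ : ℕ∞) (fun p : ℝ × ℝ => φ p.1 p.2) {p : ℝ × ℝ | 0 < p.2})
    (hφinv : GammaInvariant Γ φ)
    (v : ℝ → ℝ → ℝ → ℝ) (hv : IsSolBVP4 Γ φ v) :
    ∃ a : ℝ, ∃ C > (0:ℝ), ∃ δ > (0:ℝ), ∀ ξ : ℝ, xiStar < ξ → ξ < 0 → ∀ x y : ℝ, 0 < y →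
      |v ξ x y -
          (2 * Real.log (ξ - xiStar) +
            Real.log (1/3 - (xiStar ^ 2 / 18) * ξ + (a / 24) * (xiStar ^ 2 - ξ ^ 2)))| ≤
        C * (ξ - xiStar) ^ δ := by
  obtain ⟨K, hK, hnear⟩ := hv.abs_exp_sub_le hcc
  obtain ⟨M, hM⟩ := hv.2.2.2.1
  have hq := xiStar_neg
  set m := min (exp (-M)) (1 / 3) with hm
  have hm0 : 0 < m := by positivity
  have hC1 : 0 < K * (-2 * xiStar) / m := by
    have : 0 < -2 * xiStar := by linarith
    positivity
  have hC2 : 0 < (|M| + 2) / (-xiStar / 2) := by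
    have : 0 < -xiStar / 2 := by linarith
    positivity
  refine ⟨0, K * (-2 * xiStar) / m + (|M| + 2) / (-xiStar / 2), by positivity, 1, one_pos,
    fun ξ h1 h2 x y hy => ?_⟩
  have hs := sub_pos.2 h1
  obtain ⟨hb1, hb2⟩ := model_profile_mem h1 h2
  have hw := hM ξ h1 h2 x y hy
  rw [rpow_one, zero_div, zero_mul, add_zero, ← sub_sub]
  rcases le_total ξ (xiStar / 2) with hξ | hξ
  · have hn := hnear ξ h1 hξ x y hy
    rw [exp_eq_sq_mul_exp hs, ← mul_sub, abs_mul, abs_of_pos (by positivity), mul_left_comm] at hn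
    replace hn := le_of_mul_le_mul_left hn (by positivity)
    have hl := abs_log_sub_log_le hm0
      ((min_le_left _ _).trans (exp_le_exp.2 (abs_le.1 hw).1)) ((min_le_right _ _).trans hb1)
    rw [log_exp] at hl
    calc _ ≤ _ := hl
      _ ≤ K * (-2 * xiStar * (ξ - xiStar)) / m := by
        gcongr
        refine hn.trans ?_
        gcongr
        nlinarith
      _ = K * (-2 * xiStar) / m * (ξ - xiStar) := by ring
      _ ≤ _ := by
        gcongr
        linarith
  · have hl := abs_log_sub_log_le (by norm_num : (0 : ℝ) < 1 / 3) hb1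
      (by norm_num : (1 / 3 : ℝ) ≤ 1)
    rw [log_one, sub_zero, abs_of_nonpos (sub_nonpos.2 hb2)] at hl
    calc _ ≤ _ := abs_sub _ _
      _ ≤ |M| + 2 := by
        refine add_le_add (hw.trans (le_abs_self M)) (hl.trans ?_)
        linarith
      _ = (|M| + 2) / (-xiStar / 2) * (-xiStar / 2) := by
        rw [div_mul_cancel₀]
        linarith
      _ ≤ (|M| + 2) / (-xiStar / 2) * (ξ - xiStar) := by
        gcongr
        linarith
      _ ≤ _ := by
        gcongr
        linarith
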